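/- arXiv:0706.3044 — 2 statements merged into one kernel-verified Lean document; each statement's English description precedes it below -/
import Mathlib

section
/- Sylvester-type block determinant identity: Let R be a commutative ring, let d ≥ 1, let A be a (d−1)×(d−1) matrix over R, let B and B' be (d−1)×1 column vectors, let C and C' be 1×(d−1) row vectors, and let a, b, c, e ∈ R. Then det of the 2×2 matrix [[det(A B; C a), det(A B'; C b)], [det(A B; C' c), det(A B'; C' e)]] (whose entries are the determinants of the indicated d×d block matrices) equals det(A) times the determinant of the (d+1)×(d+1) block matrix (A B B'; C a b; C' c e). -/
namespace Matrix

variable {R m n : Type*} [CommRing R] [Fintype m] [DecidableEq m]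

theorem det_pow_card_mul_det_fromBlocks [Fintype n] [DecidableEq n]
    (A : Matrix m m R) (B : Matrix m n R) (C : Matrix n m R) (E : Matrix n n R) :
    A.det ^ Fintype.card n * (fromBlocks A B C E).det =
      A.det * (A.det • E - C * A.adjugate * B).det := by
  have h : fromBlocks 1 0 (-(C * A.adjugate)) (A.det • (1 : Matrix n n R)) *
      fromBlocks A B C E = fromBlocks A B 0 (A.det • E - C * A.adjugate * B) := by
    rw [fromBlocks_multiply]
    congr 1
    · simp
    · simp
    · simp [Matrix.mul_assoc, adjugate_mul]
    · simp [sub_eq_neg_add]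
  have hdet := congrArg det h
  rwa [det_mul, det_fromBlocks_zero₁₂, det_fromBlocks_zero₂₁, det_one, one_mul, det_smul,
    det_one, mul_one] at hdet

/-- The matrix of determinants of the one-step borderings of `A` by a column of `B`, a row of `C`
and the corresponding entry of `E`. -/
def borderedMinors (A : Matrix m m R) (B : Matrix m n R) (C : Matrix n m R)
    (E : Matrix n n R) : Matrix n n R :=
  of fun i j => (fromBlocks A (of fun k (_ : Fin 1) => B k j) (of fun (_ : Fin 1) k => C i k)
    (of fun _ _ => E i j)).det

theorem borderedMinors_eq_of_isRegular {A : Matrix m m R} (hA : IsRegular A.det)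
    (B : Matrix m n R) (C : Matrix n m R) (E : Matrix n n R) :
    borderedMinors A B C E = A.det • E - C * A.adjugate * B := by
  ext i j
  apply hA.left
  have h := det_pow_card_mul_det_fromBlocks A (of fun k (_ : Fin 1) => B k j)
    (of fun (_ : Fin 1) k => C i k) (of fun _ _ => E i j)
  rw [Fintype.card_fin, pow_one, det_fin_one] at h
  simpa [borderedMinors, mul_apply] using h

theorem det_borderedMinors_of_isRegular [Fintype n] [DecidableEq n] [Nonempty n]
    {A : Matrix m m R} (hA : IsRegular A.det)
    (B : Matrix m n R) (C : Matrix n m R) (E : Matrix n n R) :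
    (borderedMinors A B C E).det =
      A.det ^ (Fintype.card n - 1) * (fromBlocks A B C E).det := by
  apply hA.left
  simp only
  rw [borderedMinors_eq_of_isRegular hA, ← det_pow_card_mul_det_fromBlocks, ← mul_assoc,
    mul_pow_sub_one Fintype.card_ne_zero]

theorem map_borderedMinors {S : Type*} [CommRing S] (f : R →+* S) (A : Matrix m m R)
    (B : Matrix m n R) (C : Matrix n m R) (E : Matrix n n R) :
    (borderedMinors A B C E).map f =
      borderedMinors (A.map f) (B.map f) (C.map f) (E.map f) := by
  ext i j
  simp only [borderedMinors, map_apply, of_apply, RingHom.map_det, RingHom.mapMatrix_apply,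
    fromBlocks_map]
  rfl

/-- Sylvester's determinant identity. -/
theorem det_borderedMinors [Fintype n] [DecidableEq n] [Nonempty n] (A : Matrix m m R)
    (B : Matrix m n R) (C : Matrix n m R) (E : Matrix n n R) :
    (borderedMinors A B C E).det =
      A.det ^ (Fintype.card n - 1) * (fromBlocks A B C E).det := by
  have hreg : IsRegular (charmatrix (-A)).det := (charpoly_monic (-A)).isRegular
  have h := congrArg (Polynomial.evalRingHom (0 : R)) (det_borderedMinors_of_isRegular hreg
    (B.map Polynomial.C) (C.map Polynomial.C) (E.map Polynomial.C))
  have hA : (charmatrix (-A)).map (Polynomial.evalRingHom (0 : R)) = A := by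
    ext i j
    by_cases hij : i = j <;> simp [hij]
  have hC : Polynomial.evalRingHom (0 : R) ∘ Polynomial.C = id := by
    ext
    simp
  simpa only [map_mul, map_pow, RingHom.map_det, RingHom.mapMatrix_apply, map_borderedMinors,
    fromBlocks_map, hA, Matrix.map_map, hC, Matrix.map_id] using h

end Matrix

/-- **Sylvester-type block determinant identity (Lemma 6.3.14 of [V 1], used in the
proof of Proposition 6.2).**  Let `R` be a commutative ring, `A` an `m × m` matrix
(`m = d − 1`), `B, B'` columns, `C, C'` rows, and `a, b, c, e` scalars.  Then the
determinant of the `2 × 2` matrix whose entries are the determinants of the block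
matrices `(A B; C a)`, `(A B'; C b)`, `(A B; C' c)`, `(A B'; C' e)` equals
`det A` times the determinant of the block matrix `(A B B'; C a b; C' c e)`. -/
theorem sylvester_block_determinant
    {R : Type*} [CommRing R] (m : ℕ)
    (A : Matrix (Fin m) (Fin m) R)
    (B B' : Fin m → R) (C C' : Fin m → R) (a b c e : R) :
    Matrix.det
      !![Matrix.det (Matrix.fromBlocks A
            (Matrix.of fun i (_ : Fin 1) => B i)
            (Matrix.of fun (_ : Fin 1) j => C j)
            (Matrix.of fun _ _ => a)),
         Matrix.det (Matrix.fromBlocks A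
            (Matrix.of fun i (_ : Fin 1) => B' i)
            (Matrix.of fun (_ : Fin 1) j => C j)
            (Matrix.of fun _ _ => b));
         Matrix.det (Matrix.fromBlocks A
            (Matrix.of fun i (_ : Fin 1) => B i)
            (Matrix.of fun (_ : Fin 1) j => C' j)
            (Matrix.of fun _ _ => c)),
         Matrix.det (Matrix.fromBlocks A
            (Matrix.of fun i (_ : Fin 1) => B' i)
            (Matrix.of fun (_ : Fin 1) j => C' j)
            (Matrix.of fun _ _ => e))]
    = Matrix.det A *
      Matrix.det (Matrix.fromBlocks A
        (Matrix.of fun i (j : Fin 2) => if j = 0 then B i else B' i)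
        (Matrix.of fun (i : Fin 2) j => if i = 0 then C j else C' j)
        !![a, b; c, e]) := by
  have h := Matrix.det_borderedMinors A (Matrix.of fun i (j : Fin 2) => if j = 0 then B i else B' i)
    (Matrix.of fun (i : Fin 2) j => if i = 0 then C j else C' j) !![a, b; c, e]
  rw [Fintype.card_fin, Nat.add_sub_cancel 1 1, pow_one] at h
  rw [← h, Matrix.det_fin_two, Matrix.det_fin_two]
  simp [Matrix.borderedMinors]
end

section
/- Plücker-type minor identity: Let R be a commutative ring, let d ≥ 1 and m ≥ d+1, and let M be a (d+1)×m matrix over R with rows indexed 0,…,d and columns indexed 0,…,m−1. For a k-element subset K of the columns and a k-element subset S of the rows, let M[S,K] denote the determinant of the k×k submatrix with rows S and columns K (each taken in increasing order), with the convention M[∅,∅] = 1. Let I and J be d-element subsets of the columns with #(I∩J) = d−1. Then there exists ε ∈ {1, −1} such that M[{0,…,d−1}, I]·M[{0,…,d−2, d}, J] − M[{0,…,d−1}, J]·M[{0,…,d−2, d}, I] = ε · M[{0,…,d−2}, I∩J] · M[{0,…,d}, I∪J]. -/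
noncomputable section

section

open Matrix

variable {R n k : Type*} [CommRing R] [Fintype n] [DecidableEq n]

/-- A denominator-free form of the Schur complement formula for the determinant. -/
theorem det_fromBlocks_mul_det_pow [Fintype k] [DecidableEq k] (P : Matrix n n R) (Q : Matrix n k R)
    (S : Matrix k n R) (T : Matrix k k R) :
    (fromBlocks P Q S T).det * P.det ^ Fintype.card k =
      P.det * (P.det • T - S * P.adjugate * Q).det := by
  have h : fromBlocks P Q S T * fromBlocks 1 (-(P.adjugate * Q)) 0 (P.det • (1 : Matrix k k R)) =
      fromBlocks P 0 S (P.det • T - S * P.adjugate * Q) := by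
    rw [fromBlocks_multiply]
    congr 1 <;> simp [← Matrix.mul_assoc, mul_adjugate]
    abel
  have := congrArg Matrix.det h
  simpa [det_mul, det_fromBlocks_zero₂₁, det_fromBlocks_zero₁₂] using this

/-- The minor of `N` obtained by bordering its leading block with row `i` and column `j`. -/
def borderedMinor (N : Matrix (n ⊕ k) (n ⊕ k) R) (i j : k) : R :=
  (N.submatrix (Sum.map id fun _ : Fin 1 => i) (Sum.map id fun _ : Fin 1 => j)).det

theorem borderedMinor_map {S : Type*} [CommRing S] (f : R →+* S)
    (N : Matrix (n ⊕ k) (n ⊕ k) R) (i j : k) :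
    borderedMinor (N.map f) i j = f (borderedMinor N i j) := by
  rw [borderedMinor, borderedMinor, RingHom.map_det]
  rfl

theorem borderedMinor_fromBlocks {P : Matrix n n R} (hP : IsLeftRegular P.det)
    (Q : Matrix n k R) (S : Matrix k n R) (T : Matrix k k R) (i j : k) :
    borderedMinor (fromBlocks P Q S T) i j = (P.det • T - S * P.adjugate * Q) i j := by
  apply hP
  have h := det_fromBlocks_mul_det_pow P (Q.submatrix id fun _ : Fin 1 => j)
    (S.submatrix (fun _ : Fin 1 => i) id) (T.submatrix (fun _ => i) fun _ => j)
  have hN : (fromBlocks P Q S T).submatrix (Sum.map id fun _ : Fin 1 => i)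
      (Sum.map id fun _ : Fin 1 => j) = fromBlocks P (Q.submatrix id fun _ => j)
      (S.submatrix (fun _ => i) id) (T.submatrix (fun _ => i) fun _ => j) := by
    ext (_ | _) (_ | _) <;> rfl
  rw [Fintype.card_fin, pow_one, det_fin_one, mul_comm, ← hN] at h
  exact h

theorem desnanot_jacobi_of_isLeftRegular {P : Matrix n n R} (hP : IsLeftRegular P.det)
    (Q : Matrix n (Fin 2) R) (S : Matrix (Fin 2) n R) (T : Matrix (Fin 2) (Fin 2) R) :
    borderedMinor (fromBlocks P Q S T) 0 0 * borderedMinor (fromBlocks P Q S T) 1 1 -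
      borderedMinor (fromBlocks P Q S T) 0 1 * borderedMinor (fromBlocks P Q S T) 1 0 =
    P.det * (fromBlocks P Q S T).det := by
  simp only [borderedMinor_fromBlocks hP]
  rw [← det_fin_two]
  apply hP
  have h := det_fromBlocks_mul_det_pow P Q S T
  rw [Fintype.card_fin] at h
  simp only
  rw [← h]
  ring

/-- The **Desnanot–Jacobi identity**, for a matrix with a distinguished leading block. -/
theorem desnanot_jacobi (N : Matrix (n ⊕ Fin 2) (n ⊕ Fin 2) R) :
    borderedMinor N 0 0 * borderedMinor N 1 1 - borderedMinor N 0 1 * borderedMinor N 1 0 =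
      N.toBlocks₁₁.det * N.det := by
  let P : Matrix n n (Polynomial R) := charmatrix (-N.toBlocks₁₁)
  have hP : IsLeftRegular P.det := (charpoly_monic (-N.toBlocks₁₁)).isRegular.left
  have h := congrArg (Polynomial.evalRingHom 0) (desnanot_jacobi_of_isLeftRegular hP
    (N.toBlocks₁₂.map Polynomial.C) (N.toBlocks₂₁.map Polynomial.C)
    (N.toBlocks₂₂.map Polynomial.C))
  have hPN : P.map (Polynomial.evalRingHom 0) = N.toBlocks₁₁ := by
    ext i j
    by_cases hij : i = j <;> simp [P, hij]
  have hN : (fromBlocks P (N.toBlocks₁₂.map Polynomial.C) (N.toBlocks₂₁.map Polynomial.C)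
      (N.toBlocks₂₂.map Polynomial.C)).map (Polynomial.evalRingHom 0) = N := by
    rw [fromBlocks_map, hPN]
    conv_rhs => rw [← fromBlocks_toBlocks N]
    congr 1 <;> ext i j <;> simp
  simpa only [map_sub, map_mul, ← borderedMinor_map, RingHom.map_det, RingHom.mapMatrix_apply,
    hN, hPN] using h

/-- Listing the columns of a minor in another order changes it by a sign that does not depend on
the matrix. -/
theorem exists_unit_det_orderEmbOfFin {α ι : Type*} [LinearOrder α] [Fintype ι]
    [DecidableEq ι] {d : ℕ} (e : ι ≃ Fin d) {K : Finset α} (hK : K.card = d) {g : ι → α}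
    (hg : ∀ x ∈ K, ∃ i, g i = x) :
    ∃ u : ℤˣ, ∀ A : Matrix (Fin d) α R,
      (of fun p q => A p (K.orderEmbOfFin hK q)).det =
        ((u : ℤ) : R) * (A.submatrix e g).det := by
  choose f hf using fun q => hg (K.orderEmbOfFin hK q) (K.orderEmbOfFin_mem hK q)
  have hinj : Function.Injective f := fun a b hab =>
    (K.orderEmbOfFin hK).injective (by rw [← hf, ← hf, hab])
  have hbij : Function.Bijective f :=
    (Fintype.bijective_iff_injective_and_card f).2 ⟨hinj, (Fintype.card_congr e).symm⟩
  refine ⟨Equiv.Perm.sign (e.trans (Equiv.ofBijective f hbij)), fun A => ?_⟩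
  rw [← det_permute', ← det_submatrix_equiv_self e]
  congr 1
  ext p q
  simp [hf]

end

/-- **Plücker-type minor identity ((6.2.3) of the paper).**  Let `M` be a `(d+1) × m`
matrix over a commutative ring, and for a `k`-element subset `S` of the rows and a
`k`-element subset `K` of the columns let `M[S,K]` denote the determinant of the
corresponding `k × k` submatrix (rows and columns in increasing order; `M[∅,∅] = 1`).
If `I, J` are `d`-element column subsets with `#(I ∩ J) = d − 1`, then there is a sign
`ε ∈ {1, −1}` with
`M[{0,…,d−1}, I]·M[{0,…,d−2,d}, J] − M[{0,…,d−1}, J]·M[{0,…,d−2,d}, I]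
  = ε · M[{0,…,d−2}, I∩J] · M[{0,…,d}, I∪J]`. -/
theorem pluecker_minor_identity
    {R : Type*} [CommRing R] (d m : ℕ) (hd : 1 ≤ d) (hm : d + 1 ≤ m)
    (M : Matrix (Fin (d + 1)) (Fin m) R)
    (I J : Finset (Fin m)) (hI : I.card = d) (hJ : J.card = d)
    (hIJ : (I ∩ J).card = d - 1) :
    ∃ ε : R, (ε = 1 ∨ ε = -1) ∧
      Matrix.det (Matrix.of fun p q : Fin d =>
          M (Fin.castSucc p) (I.orderEmbOfFin hI q)) *
        Matrix.det (Matrix.of fun p q : Fin d =>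
          M (if (p : ℕ) = d - 1 then Fin.last d else Fin.castSucc p)
            (J.orderEmbOfFin hJ q)) -
      Matrix.det (Matrix.of fun p q : Fin d =>
          M (Fin.castSucc p) (J.orderEmbOfFin hJ q)) *
        Matrix.det (Matrix.of fun p q : Fin d =>
          M (if (p : ℕ) = d - 1 then Fin.last d else Fin.castSucc p)
            (I.orderEmbOfFin hI q))
      = ε *
        (Matrix.det (Matrix.of fun p q : Fin (d - 1) =>
            M (Fin.castLE (by omega) p) ((I ∩ J).orderEmbOfFin hIJ q)) *
          Matrix.det (Matrix.of fun p q : Fin (d + 1) =>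
            M p ((I ∪ J).orderEmbOfFin
              (by have := Finset.card_union_add_card_inter I J; omega) q))) := by
  obtain ⟨n, rfl⟩ : ∃ n, d = n + 1 := ⟨d - 1, by omega⟩
  have hU : (I ∪ J).card = n + 2 := by
    have := Finset.card_union_add_card_inter I J
    omega
  obtain ⟨a, ha⟩ := Finset.card_eq_one.1 (show (I \ J).card = 1 by
    have := Finset.card_sdiff_add_card_inter I J
    omega)
  obtain ⟨b, hb⟩ := Finset.card_eq_one.1 (show (J \ I).card = 1 by
    have := Finset.card_sdiff_add_card_inter J I
    rw [Finset.inter_comm] at this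
    omega)
  let c : Fin n → Fin m := (I ∩ J).orderEmbOfFin hIJ
  have hc : ∀ x ∈ I ∩ J, ∃ i, c i = x := fun x hx => by
    have : x ∈ Set.range c := by
      rw [Finset.range_orderEmbOfFin]
      exact hx
    exact this
  have mem_a : ∀ x ∈ I, x ∉ J → a = x := fun x hx hxJ =>
    (Finset.mem_singleton.1 (ha ▸ Finset.mem_sdiff.2 ⟨hx, hxJ⟩)).symm
  have mem_b : ∀ x ∈ J, x ∉ I → b = x := fun x hx hxI =>
    (Finset.mem_singleton.1 (hb ▸ Finset.mem_sdiff.2 ⟨hx, hxI⟩)).symm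
  obtain ⟨u, hu⟩ := exists_unit_det_orderEmbOfFin (R := R) finSumFinEquiv hI
    (g := Sum.elim c fun _ : Fin 1 => a) fun x hx => by
      by_cases hxJ : x ∈ J
      · obtain ⟨i, hi⟩ := hc x (Finset.mem_inter.2 ⟨hx, hxJ⟩)
        exact ⟨Sum.inl i, hi⟩
      · exact ⟨Sum.inr 0, mem_a x hx hxJ⟩
  obtain ⟨v, hv⟩ := exists_unit_det_orderEmbOfFin (R := R) finSumFinEquiv hJ
    (g := Sum.elim c fun _ : Fin 1 => b) fun x hx => by
      by_cases hxI : x ∈ I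
      · obtain ⟨i, hi⟩ := hc x (Finset.mem_inter.2 ⟨hxI, hx⟩)
        exact ⟨Sum.inl i, hi⟩
      · exact ⟨Sum.inr 0, mem_b x hx hxI⟩
  obtain ⟨w, hw⟩ := exists_unit_det_orderEmbOfFin (R := R) finSumFinEquiv hU
    (g := Sum.elim c ![a, b]) fun x hx => by
      by_cases hxI : x ∈ I
      · by_cases hxJ : x ∈ J
        · obtain ⟨i, hi⟩ := hc x (Finset.mem_inter.2 ⟨hxI, hxJ⟩)
          exact ⟨Sum.inl i, hi⟩
        · exact ⟨Sum.inr 0, mem_a x hxI hxJ⟩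
      · exact ⟨Sum.inr 1, mem_b x ((Finset.mem_union.1 hx).resolve_left hxI) hxI⟩
  let N : Matrix (Fin n ⊕ Fin 2) (Fin n ⊕ Fin 2) R :=
    M.submatrix finSumFinEquiv (Sum.elim c ![a, b])
  let r (p : Fin (n + 1)) : Fin (n + 2) :=
    if (p : ℕ) = n then Fin.last (n + 1) else Fin.castSucc p
  have hcol (j : Fin 2) : Sum.elim c (fun _ : Fin 1 => ![a, b] j) =
      Sum.elim c ![a, b] ∘ Sum.map id fun _ : Fin 1 => j := by
    ext (_ | _) <;> rfl
  have hrow0 : Fin.castSucc ∘ (finSumFinEquiv : Fin n ⊕ Fin 1 ≃ Fin (n + 1)) =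
      (finSumFinEquiv : Fin n ⊕ Fin 2 ≃ Fin (n + 2)) ∘ Sum.map id fun _ : Fin 1 => 0 := by
    ext (i | i) <;> simp
  have hrow1 : r ∘ (finSumFinEquiv : Fin n ⊕ Fin 1 ≃ Fin (n + 1)) =
      (finSumFinEquiv : Fin n ⊕ Fin 2 ≃ Fin (n + 2)) ∘ Sum.map id fun _ : Fin 1 => 1 := by
    ext (i | i)
    · simp [r, i.isLt.ne]
    · simp [r]
  have hminor0 (j : Fin 2) : ((M.submatrix Fin.castSucc id).submatrix finSumFinEquiv
      (Sum.elim c fun _ : Fin 1 => ![a, b] j)).det = borderedMinor N 0 j := by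
    rw [hcol, Matrix.submatrix_submatrix, hrow0]
    rfl
  have hminor1 (j : Fin 2) : ((M.submatrix r id).submatrix finSumFinEquiv
      (Sum.elim c fun _ : Fin 1 => ![a, b] j)).det = borderedMinor N 1 j := by
    rw [hcol, Matrix.submatrix_submatrix, hrow1]
    rfl
  have hI0 := (hu (M.submatrix Fin.castSucc id)).trans (congrArg _ (hminor0 0))
  have hI1 := (hu (M.submatrix r id)).trans (congrArg _ (hminor1 0))
  have hJ0 := (hv (M.submatrix Fin.castSucc id)).trans (congrArg _ (hminor0 1))
  have hJ1 := (hv (M.submatrix r id)).trans (congrArg _ (hminor1 1))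
  have hD := desnanot_jacobi N
  have hww : ((w : ℤ) : R) * ((w : ℤ) : R) = 1 := by
    rw [← Int.cast_mul, ← Units.val_mul, Int.units_mul_self, Units.val_one, Int.cast_one]
  refine ⟨(((u * v * w : ℤˣ) : ℤ) : R), ?_, ?_⟩
  · rcases Int.units_eq_one_or (u * v * w) with h | h <;> simp [h]
  · refine (congrArg₂ (· - ·) (congrArg₂ (· * ·) hI0 hJ1) (congrArg₂ (· * ·) hJ0 hI1)).trans ?_
    refine Eq.trans ?_ (congrArg (fun t => _ * (N.toBlocks₁₁.det * t)) (hw M)).symm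
    simp only [Units.val_mul, Int.cast_mul]
    linear_combination ((u : ℤ) : R) * ((v : ℤ) : R) * hD -
      ((u : ℤ) : R) * ((v : ℤ) : R) * N.toBlocks₁₁.det * N.det * hww
end
end
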